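/- arXiv:1608.02107 — 2 statements merged into one kernel-verified Lean document; each statement's English description precedes it below -/
import Mathlib

section
/- For any finite nonempty simple graphs G and H without isolated vertices, γ(G □ H) ≥ (γ(G)/(2·γ(G)−1)) · γ(G) · γ(H), i.e., γ(G □ H) ≥ γ(G)²·γ(H)/(2·γ(G)−1). -/
open Finset

/-- `s` is a dominating set of `G`: every vertex is in `s` or adjacent to a vertex of `s`. -/
def IsDominatingSet {V : Type*} (G : SimpleGraph V) (s : Set V) : Prop :=
  ∀ v : V, v ∈ s ∨ ∃ u ∈ s, G.Adj u v

/-- The domination number `γ(G)`: minimum cardinality of a dominating set. -/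
noncomputable def domNum {V : Type*} [Fintype V] (G : SimpleGraph V) : ℕ :=
  sInf {n : ℕ | ∃ s : Set V, IsDominatingSet G s ∧ s.ncard = n}

/-- The allegiance `a_G(D) = max_{v ∈ V} |D ∩ N[v]|` (closed neighborhoods). -/
noncomputable def allegiance {V : Type*} [Fintype V] (G : SimpleGraph V) (D : Set V) : ℕ :=
  Finset.univ.sup fun v : V => (D ∩ (insert v (G.neighborSet v))).ncard

/-- The power `π(G)`: minimum allegiance over all minimum dominating sets (γ-sets) of `G`. -/
noncomputable def graphPower {V : Type*} [Fintype V] (G : SimpleGraph V) : ℕ :=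
  sInf {a : ℕ | ∃ D : Set V, IsDominatingSet G D ∧ D.ncard = domNum G ∧ allegiance G D = a}

section

variable {V W : Type*}

lemma IsDominatingSet.domNum_le_card [Fintype V] {G : SimpleGraph V} {s : Finset V}
    (hs : IsDominatingSet G (s : Set V)) : domNum G ≤ s.card :=
  Nat.sInf_le ⟨s, hs, Set.ncard_coe_finset s⟩

lemma exists_isDominatingSet_card_eq_domNum [Fintype V] (G : SimpleGraph V) :
    ∃ s : Finset V, IsDominatingSet G (s : Set V) ∧ s.card = domNum G := by
  classical
  obtain ⟨s, hs, hcard⟩ := Nat.sInf_mem (s := {n : ℕ | ∃ s : Set V, IsDominatingSet G s ∧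
    s.ncard = n}) ⟨_, Set.univ, fun v => Or.inl (Set.mem_univ v), rfl⟩
  exact ⟨s.toFinset, by simpa using hs, by rw [← Set.ncard_eq_toFinset_card']; exact hcard⟩

lemma domNum_pos [Fintype V] [Nonempty V] (G : SimpleGraph V) : 0 < domNum G := by
  obtain ⟨s, hs, hcard⟩ := exists_isDominatingSet_card_eq_domNum G
  rw [← hcard, Finset.card_pos]
  obtain h | ⟨u, hu, -⟩ := hs (Classical.arbitrary V)
  · exact ⟨_, h⟩
  · exact ⟨u, hu⟩

lemma IsDominatingSet.image_iso {G : SimpleGraph V} {H : SimpleGraph W} (e : G ≃g H)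
    {s : Set V} (hs : IsDominatingSet G s) : IsDominatingSet H (e '' s) := by
  intro w
  obtain h | ⟨u, hu, huw⟩ := hs (e.symm w)
  · exact Or.inl ⟨_, h, e.apply_symm_apply w⟩
  · refine Or.inr ⟨e u, ⟨u, hu, rfl⟩, ?_⟩
    have := e.map_adj_iff.mpr huw
    rwa [e.apply_symm_apply] at this

/-- The projection of a dominating set of `G □ H` to `G` dominates `G`. -/
lemma IsDominatingSet.image_fst [Nonempty W] {G : SimpleGraph V} {H : SimpleGraph W}
    {D : Set (V × W)} (hD : IsDominatingSet (G □ H) D) :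
    IsDominatingSet G (Prod.fst '' D) := by
  intro v
  obtain h | ⟨⟨a, b⟩, hab, hadj⟩ := hD (v, Classical.arbitrary W)
  · exact Or.inl ⟨_, h, rfl⟩
  · rw [SimpleGraph.boxProd_adj] at hadj
    obtain ⟨h, -⟩ | ⟨-, h⟩ := hadj
    · exact Or.inr ⟨a, ⟨_, hab, rfl⟩, h⟩
    · exact Or.inl ⟨_, hab, h⟩

lemma IsDominatingSet.exists_retraction {G : SimpleGraph V} {U : Set V}
    (hU : IsDominatingSet G U) :
    ∃ f : V → V, (∀ v, f v ∈ U) ∧ (∀ v, f v = v ∨ G.Adj (f v) v) ∧ ∀ u ∈ U, f u = u := by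
  have h : ∀ v, ∃ u, u ∈ U ∧ (u = v ∨ G.Adj u v) ∧ (v ∈ U → u = v) := by
    intro v
    by_cases hv : v ∈ U
    · exact ⟨v, hv, Or.inl rfl, fun _ => rfl⟩
    · obtain h | ⟨u, hu, huv⟩ := hU v
      · exact absurd h hv
      · exact ⟨u, hu, Or.inr huv, fun h => absurd h hv⟩
  choose f hf using h
  exact ⟨f, fun v => (hf v).1, fun v => (hf v).2.1, fun v => (hf v).2.2⟩

/-- A set which is smallest among the dominating sets of `G` contained in the projection of `D`
yields the bound: count the cells `f ⁻¹' {u} × {w}` having no vertex of `D` in the columns of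
`f ⁻¹' {u}` over the closed neighborhood of `w`, first by `u` and then by `w`. -/
lemma IsDominatingSet.domNum_mul_succ_le [Fintype V] [Fintype W] [Nonempty W]
    {G : SimpleGraph V} {H : SimpleGraph W} {D : Finset (V × W)}
    (hD : IsDominatingSet (G □ H) (D : Set (V × W))) :
    domNum G * (domNum H + 1) ≤ 2 * D.card := by
  classical
  obtain ⟨U, hUmem, hUmin⟩ := Finset.exists_min_image
    ((D.image Prod.fst).powerset.filter fun s : Finset V => IsDominatingSet G (s : Set V))
    Finset.card
    ⟨D.image Prod.fst, by simpa using hD.image_fst⟩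
  simp only [Finset.mem_filter, Finset.mem_powerset] at hUmem hUmin
  obtain ⟨hUD, hU⟩ := hUmem
  obtain ⟨f, hfU, hf, hfix⟩ := hU.exists_retraction
  set L : Finset (V × W) := (U ×ˢ Finset.univ).filter fun p =>
    ∀ q ∈ D, f q.1 = p.1 → ¬ (q.2 = p.2 ∨ H.Adj q.2 p.2) with hL
  have hcol : ∀ u ∈ U, domNum H ≤
      (D.filter fun p => f p.1 = u).card + (L.filter fun p => p.1 = u).card := by
    intro u hu
    have hdom : IsDominatingSet H (((D.filter fun p => f p.1 = u).image Prod.snd ∪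
        (L.filter fun p => p.1 = u).image Prod.snd : Finset W) : Set W) := by
      intro w
      by_cases hw : (u, w) ∈ L
      · left
        simp only [Finset.coe_union, Set.mem_union, Finset.mem_coe, Finset.mem_image]
        exact Or.inr ⟨(u, w), by simp [hw], rfl⟩
      · simp only [hL, Finset.mem_filter, Finset.mem_product, hu, Finset.mem_univ, true_and,
          not_forall, not_not] at hw
        obtain ⟨q, hq, hqu, hqw⟩ := hw
        have hmem : q.2 ∈ (((D.filter fun p => f p.1 = u).image Prod.snd ∪
            (L.filter fun p => p.1 = u).image Prod.snd : Finset W) : Set W) := by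
          simp only [Finset.coe_union, Set.mem_union, Finset.mem_coe, Finset.mem_image]
          exact Or.inl ⟨q, by simp [hq, hqu], rfl⟩
        obtain h | h := hqw
        · exact Or.inl (h ▸ hmem)
        · exact Or.inr ⟨q.2, hmem, h⟩
    exact hdom.domNum_le_card.trans ((Finset.card_union_le _ _).trans
      (Nat.add_le_add Finset.card_image_le Finset.card_image_le))
  have hrow : ∀ w : W, (L.filter fun p => p.2 = w).card +
      ((D.filter fun p => p.1 ∈ U).filter fun p => p.2 = w).card ≤
      (D.filter fun p => p.2 = w).card := by
    intro w
    have hinj : ∀ S : Finset (V × W),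
        ((S.filter fun p => p.2 = w).image Prod.fst).card = (S.filter fun p => p.2 = w).card := by
      intro S
      refine Finset.card_image_of_injOn ?_
      intro p hp q hq hpq
      simp only [Finset.coe_filter, Set.mem_ofPred_eq] at hp hq
      exact Prod.ext hpq (hp.2.trans hq.2.symm)
    rw [← hinj L, ← hinj D, ← hinj (D.filter fun p => p.1 ∈ U)]
    set A := (D.filter fun p => p.2 = w).image Prod.fst with hA
    set B := (L.filter fun p => p.2 = w).image Prod.fst with hB
    have memA : ∀ v, v ∈ A ↔ (v, w) ∈ D := by intro v; simp [hA]
    have memB : ∀ v, v ∈ B ↔ (v, w) ∈ L := by intro v; simp [hB]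
    have hBU : B ⊆ U := by
      intro v hv
      rw [memB, hL] at hv
      exact (Finset.mem_product.mp (Finset.mem_filter.mp hv).1).1
    have hdisj : Disjoint A B := by
      rw [Finset.disjoint_left]
      intro v hvA hvB
      have hvU := hfix v (hBU hvB)
      rw [memA] at hvA
      rw [memB, hL] at hvB
      exact (Finset.mem_filter.mp hvB).2 _ hvA hvU (Or.inl rfl)
    have hAU : ((D.filter fun p => p.1 ∈ U).filter fun p => p.2 = w).image Prod.fst = A ∩ U := by
      ext v
      simp [memA]
    have hdom : IsDominatingSet G ((A ∪ (U \ B) : Finset V) : Set V) := by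
      intro v
      by_cases hv : f v ∈ B
      · have hvL := (Finset.mem_filter.mp ((memB _).mp hv)).2
        obtain h | ⟨⟨a, b⟩, hab, hadj⟩ := hD (v, w)
        · exact absurd (Or.inl rfl) (hvL (v, w) h rfl)
        · rw [SimpleGraph.boxProd_adj] at hadj
          obtain ⟨h, hb⟩ | ⟨h, ha⟩ := hadj
          · obtain rfl : b = w := hb
            refine Or.inr ⟨a, ?_, h⟩
            exact Finset.mem_union_left _ ((memA a).mpr hab)
          · obtain rfl : a = v := ha
            exact absurd (Or.inr h) (hvL (a, b) hab rfl)
      · have hmem : f v ∈ ((A ∪ (U \ B) : Finset V) : Set V) :=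
          Finset.mem_union_right _ (Finset.mem_sdiff.mpr ⟨hfU v, hv⟩)
        obtain h | h := hf v
        · exact Or.inl (h ▸ hmem)
        · exact Or.inr ⟨_, hmem, h⟩
    have hsub : A ∪ (U \ B) ⊆ D.image Prod.fst := by
      refine Finset.union_subset ?_ (Finset.sdiff_subset.trans hUD)
      exact Finset.image_subset_image (Finset.filter_subset _ _)
    have hmin := hUmin _ ⟨hsub, hdom⟩
    have hunion := Finset.card_union_add_card_inter A (U \ B)
    have hinter : A ∩ (U \ B) = A ∩ U := by
      ext v
      simp only [Finset.mem_inter, Finset.mem_sdiff]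
      exact ⟨fun h => ⟨h.1, h.2.1⟩,
        fun h => ⟨h.1, h.2, fun hB => Finset.disjoint_left.mp hdisj h.1 hB⟩⟩
    have hsdiff := Finset.card_sdiff_add_card_eq_card hBU
    rw [hinter] at hunion
    rw [hAU]
    omega
  have hcolsum : U.card * domNum H ≤ D.card + L.card := by
    rw [Finset.card_eq_sum_card_fiberwise (s := D) (t := U) (f := fun p => f p.1)
      fun p _ => hfU p.1,
      Finset.card_eq_sum_card_fiberwise (s := L) (t := U) (f := Prod.fst)
      fun p hp => (Finset.mem_product.mp (Finset.mem_filter.mp hp).1).1,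
      ← Finset.sum_add_distrib, ← smul_eq_mul]
    exact Finset.card_nsmul_le_sum _ _ _ hcol
  have hrowsum : L.card + (D.filter fun p => p.1 ∈ U).card ≤ D.card := by
    have hfiber : ∀ S : Finset (V × W),
        S.card = ∑ w : W, (S.filter fun p => p.2 = w).card := fun S =>
      Finset.card_eq_sum_card_fiberwise fun p _ => Finset.mem_coe.mpr (Finset.mem_univ p.2)
    rw [hfiber L, hfiber D, hfiber (D.filter fun p => p.1 ∈ U), ← Finset.sum_add_distrib]
    exact Finset.sum_le_sum fun w _ => hrow w
  have hgain : U.card ≤ (D.filter fun p => p.1 ∈ U).card := by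
    refine (Finset.card_le_card fun u hu => ?_).trans
      (Finset.card_image_le (s := D.filter fun p => p.1 ∈ U) (f := Prod.fst))
    obtain ⟨p, hp, rfl⟩ := Finset.mem_image.mp (hUD hu)
    exact Finset.mem_image_of_mem _ (Finset.mem_filter.mpr ⟨hp, hu⟩)
  calc domNum G * (domNum H + 1) ≤ U.card * (domNum H + 1) :=
        Nat.mul_le_mul_right _ hU.domNum_le_card
    _ ≤ 2 * D.card := by rw [Nat.mul_succ]; omega

lemma domNum_mul_succ_le_two_mul_domNum_boxProd [Fintype V] [Fintype W] [Nonempty V]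
    (G : SimpleGraph V) (H : SimpleGraph W) :
    domNum H * (domNum G + 1) ≤ 2 * domNum (G □ H) := by
  classical
  obtain ⟨D, hD, hcard⟩ := exists_isDominatingSet_card_eq_domNum (G □ H)
  have hswap := hD.image_iso (SimpleGraph.boxProdComm G H)
  rw [← Finset.coe_image] at hswap
  rw [← hcard]
  exact hswap.domNum_mul_succ_le.trans (Nat.mul_le_mul_left 2 Finset.card_image_le)

end

/-- For finite nonempty graphs `G`, `H` without isolated vertices,
`γ(G □ H) ≥ (γ(G)/(2γ(G)−1))·γ(G)·γ(H)`. -/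
theorem domNum_boxProd_ge_domNum_bound {V W : Type*} [Fintype V] [Fintype W]
    [Nonempty V] [Nonempty W] (G : SimpleGraph V) (H : SimpleGraph W)
    (hG : ∀ v : V, ∃ u : V, G.Adj u v) (hH : ∀ w : W, ∃ u : W, H.Adj u w) :
    (domNum (G □ H) : ℝ) ≥
      (domNum G : ℝ) / (2 * (domNum G : ℝ) - 1) * (domNum G : ℝ) * (domNum H : ℝ) := by
  have hk : (1 : ℝ) ≤ domNum G := by exact_mod_cast domNum_pos G
  have hm : (0 : ℝ) ≤ domNum H := Nat.cast_nonneg _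
  have hmain : (domNum H : ℝ) * (domNum G + 1) ≤ 2 * domNum (G □ H) := by
    exact_mod_cast domNum_mul_succ_le_two_mul_domNum_boxProd G H
  have hden : (0 : ℝ) < 2 * (domNum G : ℝ) - 1 := by linarith
  rw [ge_iff_le, div_mul_eq_mul_div, div_mul_eq_mul_div, div_le_iff₀ hden]
  nlinarith [mul_le_mul_of_nonneg_right hmain hden.le, mul_nonneg hm (sub_nonneg.mpr hk)]
end

section
/- For any finite connected simple graph G with at least two vertices, π(G) ≤ Δ(G), where Δ(G) is the maximum degree of G. -/
open Finset

/-- A vertex with a neighbor can be dropped from a dominating set containing all its neighbors. -/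
theorem IsDominatingSet.sdiff_singleton {V : Type*} {G : SimpleGraph V} {D : Set V}
    (hD : IsDominatingSet G D) {v w : V} (hvw : G.Adj v w) (hv : G.neighborSet v ⊆ D) :
    IsDominatingSet G (D \ {v}) := by
  intro u
  by_cases huv : u = v
  · subst huv
    exact Or.inr ⟨w, ⟨hv hvw, hvw.ne'⟩, hvw.symm⟩
  · by_cases hu : u ∈ D
    · exact Or.inl ⟨hu, huv⟩
    · obtain h | ⟨x, hx, hxu⟩ := hD u
      · exact absurd h hu
      · refine Or.inr ⟨x, ⟨hx, ?_⟩, hxu⟩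
        rintro rfl
        exact hu (hv hxu)

theorem domNum_le_ncard {V : Type*} [Fintype V] {G : SimpleGraph V} {D : Set V}
    (hD : IsDominatingSet G D) : domNum G ≤ D.ncard :=
  Nat.sInf_le ⟨D, hD, rfl⟩

theorem exists_isDominatingSet_ncard_eq_domNum {V : Type*} [Fintype V] (G : SimpleGraph V) :
    ∃ D : Set V, IsDominatingSet G D ∧ D.ncard = domNum G :=
  Nat.sInf_mem (s := {n : ℕ | ∃ s : Set V, IsDominatingSet G s ∧ s.ncard = n})
    ⟨_, Set.univ, fun v => Or.inl (Set.mem_univ v), rfl⟩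

/-- In a minimum dominating set, every non-isolated vertex has a closed neighbor outside the set. -/
theorem exists_notMem_of_ncard_eq_domNum {V : Type*} [Fintype V] {G : SimpleGraph V} {D : Set V}
    (hD : IsDominatingSet G D) (hcard : D.ncard = domNum G) {v w : V} (hvw : G.Adj v w) :
    ∃ x ∈ insert v (G.neighborSet v), x ∉ D := by
  by_contra! h
  have hlt := Set.ncard_sdiff_singleton_lt_of_mem (h v (Set.mem_insert v _))
  have hle := domNum_le_ncard
    (hD.sdiff_singleton hvw fun x hx => h x (Set.mem_insert_of_mem v hx))
  omega

theorem allegiance_le_maxDegree {V : Type*} [Fintype V] {G : SimpleGraph V} [DecidableRel G.Adj]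
    (hG : ∀ v, ∃ w, G.Adj v w) {D : Set V} (hD : IsDominatingSet G D)
    (hcard : D.ncard = domNum G) : allegiance G D ≤ G.maxDegree := by
  refine Finset.sup_le fun v _ => ?_
  obtain ⟨w, hvw⟩ := hG v
  obtain ⟨x, hx, hxD⟩ := exists_notMem_of_ncard_eq_domNum hD hcard hvw
  have hlt : (D ∩ insert v (G.neighborSet v)).ncard < (insert v (G.neighborSet v)).ncard :=
    Set.ncard_lt_ncard ⟨Set.inter_subset_right, fun h => hxD (h hx).1⟩
  have hle := Set.ncard_insert_le v (G.neighborSet v)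
  have hdeg : (G.neighborSet v).ncard = G.degree v := by
    rw [Set.ncard_eq_toFinset_card', ← G.card_neighborFinset_eq_degree]; rfl
  have hmax := G.degree_le_maxDegree v
  omega

theorem graphPower_le_allegiance {V : Type*} [Fintype V] {G : SimpleGraph V} {D : Set V}
    (hD : IsDominatingSet G D) (hcard : D.ncard = domNum G) : graphPower G ≤ allegiance G D :=
  Nat.sInf_le ⟨D, hD, hcard, rfl⟩

/-- For any finite connected graph `G` with at least two vertices,
`π(G) ≤ Δ(G)`. -/
theorem graphPower_le_maxDegree {V : Type*} [Fintype V] (G : SimpleGraph V)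
    [DecidableRel G.Adj] (hconn : G.Connected) (hcard : 1 < Fintype.card V) :
    graphPower G ≤ G.maxDegree := by
  have : Nontrivial V := Fintype.one_lt_card_iff_nontrivial.mp hcard
  obtain ⟨D, hD, hDcard⟩ := exists_isDominatingSet_ncard_eq_domNum G
  exact (graphPower_le_allegiance hD hDcard).trans
    (allegiance_le_maxDegree (fun v => hconn.preconnected.exists_adj_of_nontrivial v) hD hDcard)
end
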